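/- arXiv:2512.04874 — 2 statements merged into one kernel-verified Lean document; each statement's English description precedes it below -/
import Mathlib

section
/- Let U ⊆ ℋ be a closed subspace with orthogonal projection P_U, and assume T_n = P_U T_n P_U for all n ≥ 1. Then for every n ≥ 0: (i) both U and its orthogonal complement U^⊥ are invariant under R_n (so U and U^⊥ reduce R_n), and (ii) R_n x = x for every x ∈ U^⊥. -/
set_option synthInstance.maxHeartbeats 1000000
set_option maxHeartbeats 1000000

open Filter Topology ContinuousLinearMap
open scoped ComplexOrder

/-- The shorting iterates: `R 0 = I` and `R (n+1) = R n ^ (1/2) * (I - T (n+1)) * R n ^ (1/2)`,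
where `CFC.sqrt` is the positive square root (from the continuous functional calculus). -/
noncomputable def shortR {ℋ : Type*} [NormedAddCommGroup ℋ] [InnerProductSpace ℂ ℋ]
    [CompleteSpace ℋ] (T : ℕ → ℋ →L[ℂ] ℋ) : ℕ → ℋ →L[ℂ] ℋ
  | 0 => 1
  | n + 1 => CFC.sqrt (shortR T n) * (1 - T (n + 1)) * CFC.sqrt (shortR T n)

/-- The orthogonal projection of `ℋ` onto a (closed) subspace `U`, as an operator `ℋ →L[ℂ] ℋ`. -/
noncomputable def projCLM {ℋ : Type*} [NormedAddCommGroup ℋ] [InnerProductSpace ℂ ℋ]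
    (U : Submodule ℂ ℋ) [U.HasOrthogonalProjection] : ℋ →L[ℂ] ℋ :=
  U.subtypeL ∘L U.orthogonalProjectionOnto

theorem shortR_nonneg_aux {ℋ : Type*} [NormedAddCommGroup ℋ] [InnerProductSpace ℂ ℋ]
    [CompleteSpace ℋ] (T : ℕ → ℋ →L[ℂ] ℋ) (hT : ∀ n, 1 ≤ n → 0 ≤ T n ∧ T n ≤ 1) (n : ℕ) :
    0 ≤ shortR T n := by
  cases n with
  | zero => exact zero_le_one
  | succ n =>
    have hs : IsSelfAdjoint (CFC.sqrt (shortR T n)) :=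
      IsSelfAdjoint.of_nonneg (CFC.sqrt_nonneg _)
    exact hs.conjugate_nonneg (sub_nonneg.2 (hT (n + 1) (by omega)).2)

theorem sqrt_fix_aux {ℋ : Type*} [NormedAddCommGroup ℋ] [InnerProductSpace ℂ ℋ]
    [CompleteSpace ℋ] (R : ℋ →L[ℂ] ℋ) (hR : 0 ≤ R) (x : ℋ) (hx : R x = x) :
    CFC.sqrt R x = x := by
  have hS : 0 ≤ CFC.sqrt R := CFC.sqrt_nonneg _
  have hm : CFC.sqrt R * CFC.sqrt R = R := CFC.sqrt_mul_sqrt_self R hR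
  generalize CFC.sqrt R = S at hS hm ⊢
  have hp : S.IsPositive := (ContinuousLinearMap.nonneg_iff_isPositive S).1 hS
  have h1 : S (S x) = x := by
    rw [← mul_apply_eq_comp, hm, hx]
  have h2 : S (S x - x) = -(S x - x) := by
    rw [map_sub, h1]; abel
  have h3 := hp.re_inner_nonneg_left (S x - x)
  rw [h2, inner_neg_left, map_neg, inner_self_eq_norm_sq] at h3
  have h4 : ‖S x - x‖ = 0 := by nlinarith [norm_nonneg (S x - x)]
  exact sub_eq_zero.1 (norm_eq_zero.1 h4)

/-- If the effects are supported in the closed subspace `U` (i.e. `T n = P_U T n P_U`), then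
`U` and `Uᗮ` are invariant under every iterate `R n` (so they reduce `R n`), and `R n` acts
as the identity on `Uᗮ`. -/
theorem shorting_reduces {ℋ : Type*} [NormedAddCommGroup ℋ]
    [InnerProductSpace ℂ ℋ] [CompleteSpace ℋ]
    (U : Submodule ℂ ℋ) [CompleteSpace U]
    (T : ℕ → ℋ →L[ℂ] ℋ) (hT : ∀ n, 1 ≤ n → 0 ≤ T n ∧ T n ≤ 1)
    (hTU : ∀ n, 1 ≤ n → T n = projCLM U ∘L (T n ∘L projCLM U)) :
    ∀ n : ℕ, (∀ x ∈ U, shortR T n x ∈ U) ∧ (∀ x ∈ Uᗮ, shortR T n x ∈ Uᗮ) ∧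
      (∀ x ∈ Uᗮ, shortR T n x = x) := by
  have key : ∀ n : ℕ, ∀ x ∈ Uᗮ, shortR T n x = x := by
    intro n
    induction n with
    | zero => intro x _; rfl
    | succ n ih =>
      intro x hx
      have hs := sqrt_fix_aux _ (shortR_nonneg_aux T hT n) x (ih x hx)
      have hP : projCLM U x = 0 := by
        rw [projCLM, ContinuousLinearMap.comp_apply, Submodule.orthogonalProjectionOnto_eq_zero_iff.2 hx, map_zero]
      have hTx : T (n + 1) x = 0 := by
        rw [hTU (n + 1) (by omega)]
        simp [hP]
      simp [shortR, hs, hTx]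
  intro n
  refine ⟨?_, ?_, key n⟩
  · intro x hx
    have hp : (shortR T n).IsPositive :=
      (ContinuousLinearMap.nonneg_iff_isPositive _).1 (shortR_nonneg_aux T hT n)
    rw [← Submodule.orthogonal_orthogonal U, Submodule.mem_orthogonal']
    intro v hv
    rw [hp.isSymmetric.apply_clm, key n v hv]
    exact Submodule.inner_right_of_mem_orthogonal hx hv
  · intro x hx
    rw [key n x hx]
    exact hx
end

section
/- Assume the feature map V is minimal, i.e., the span of { V(s) h : s ∈ S, h ∈ H } is dense in ℋ, and set K_0(s,t) := V(s)* V(t). Let K̃ : S × S → B(H) be a positive definite kernel such that K_0 − K̃ is also positive definite. Then there exists a unique operator Q ∈ B(ℋ) with 0 ≤ Q ≤ I such that K̃(s,t) = V(s)* Q V(t) for all s, t ∈ S. -/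
set_option synthInstance.maxHeartbeats 1000000
set_option maxHeartbeats 1000000

open Filter Topology ContinuousLinearMap
open scoped ComplexOrder

/-- A `B(H)`-valued kernel `K : S × S → B(H)` is positive definite if
`∑ i j, ⟨h i, K (s i) (s j) (h j)⟩ ≥ 0` for all finite tuples. -/
def IsPosDefKernel {H S : Type*} [NormedAddCommGroup H] [InnerProductSpace ℂ H]
    (K : S → S → H →L[ℂ] H) : Prop :=
  ∀ (m : ℕ) (s : Fin m → S) (h : Fin m → H),
    (0 : ℂ) ≤ ∑ i, ∑ j, (inner ℂ (h i) ((K (s i) (s j)) (h j)) : ℂ)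

/-- The sesquilinear form on finitely supported functions attached to a kernel. -/
noncomputable def kerForm {H S : Type*} [NormedAddCommGroup H] [InnerProductSpace ℂ H]
    (K : S → S → H →L[ℂ] H) (f g : S →₀ H) : ℂ :=
  f.sum fun s x => inner ℂ x (Finsupp.lsum ℂ (fun t => (K s t).toLinearMap) g)

section KerForm
variable {H S : Type*} [NormedAddCommGroup H] [InnerProductSpace ℂ H]
  (K : S → S → H →L[ℂ] H)

lemma kerForm_add_left (f g k : S →₀ H) :
    kerForm K (f + g) k = kerForm K f k + kerForm K g k := by
  classical
  unfold kerForm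
  exact Finsupp.sum_add_index' (by simp) (by intros; rw [inner_add_left])

lemma kerForm_smul_left (c : ℂ) (f k : S →₀ H) :
    kerForm K (c • f) k = (starRingEnd ℂ) c * kerForm K f k := by
  unfold kerForm
  rw [Finsupp.sum_smul_index' (by simp)]
  simp only [inner_smul_left, Finsupp.sum, Finset.mul_sum]

lemma kerForm_add_right (f g k : S →₀ H) :
    kerForm K k (f + g) = kerForm K k f + kerForm K k g := by
  unfold kerForm
  simp only [map_add, inner_add_right, Finsupp.sum_add]

lemma kerForm_smul_right (c : ℂ) (f k : S →₀ H) :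
    kerForm K k (c • f) = c * kerForm K k f := by
  unfold kerForm
  simp only [map_smul, inner_smul_right, Finsupp.sum, Finset.mul_sum]

lemma kerForm_single (s t : S) (x y : H) :
    kerForm K (Finsupp.single s x) (Finsupp.single t y) = inner ℂ x (K s t y) := by
  simp [kerForm]

lemma kerForm_nonneg (hK : IsPosDefKernel K) (f : S →₀ H) : 0 ≤ kerForm K f f := by
  have h := hK f.support.card (fun i => (f.support.equivFin.symm i : S))
    (fun i => f (f.support.equivFin.symm i : S))
  convert h using 1
  rw [Equiv.sum_comp f.support.equivFin.symm (fun a : f.support =>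
    ∑ j, inner ℂ (f a) (K a (f.support.equivFin.symm j : S) (f (f.support.equivFin.symm j : S))))]
  unfold kerForm Finsupp.sum
  rw [← Finset.sum_coe_sort]
  refine Finset.sum_congr rfl fun a _ => ?_
  rw [Equiv.sum_comp f.support.equivFin.symm (fun b : f.support =>
    inner ℂ (f a) (K a b (f b)))]
  beta_reduce
  rw [Finsupp.lsum_apply, Finsupp.sum, inner_sum, ← Finset.sum_coe_sort]
  rfl

lemma kerForm_symm (hK : IsPosDefKernel K) (f g : S →₀ H) :
    (starRingEnd ℂ) (kerForm K g f) = kerForm K f g := by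
  have im0 : ∀ f, (kerForm K f f).im = 0 := fun f =>
    ((Complex.le_def.1 (kerForm_nonneg K hK f)).2).symm
  have h1 := im0 (f + g)
  have h2 := im0 (f + Complex.I • g)
  have h3 := im0 f
  have h4 := im0 g
  simp only [kerForm_add_left, kerForm_add_right, kerForm_smul_left, kerForm_smul_right] at h1 h2
  simp at h1 h2
  apply Complex.ext <;> simp <;> linarith

/-- The pre-inner product attached to a positive definite kernel. -/
@[reducible]
noncomputable def kerCore (hK : IsPosDefKernel K) : PreInnerProductSpace.Core ℂ (S →₀ H) where
  inner := kerForm K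
  conj_inner_symm f g := kerForm_symm K hK f g
  re_inner_nonneg f := (Complex.le_def.1 (kerForm_nonneg K hK f)).1
  add_left f g k := kerForm_add_left K f g k
  smul_left f g c := kerForm_smul_left K c f g

end KerForm

universe u in
lemma exists_gns {E : Type u} [AddCommGroup E] [Module ℂ E] (c : PreInnerProductSpace.Core ℂ E) :
    ∃ (F : Type u) (_ : NormedAddCommGroup F) (_ : InnerProductSpace ℂ F) (_ : CompleteSpace F)
      (W : E →ₗ[ℂ] F), ∀ f g, inner ℂ (W f) (W g) = c.inner f g := by
  let _ : SeminormedAddCommGroup E := InnerProductSpace.Core.toSeminormedAddCommGroup (c := c)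
  let _ : InnerProductSpace ℂ E := InnerProductSpace.ofCore c
  refine ⟨UniformSpace.Completion E, inferInstance, inferInstance, inferInstance,
    (UniformSpace.Completion.toComplL (𝕜 := ℂ) (E := E)).toLinearMap, fun f g => ?_⟩
  exact UniformSpace.Completion.inner_coe f g

/-- The synthesis operator of a feature map. -/
noncomputable def synth {ℋ H S : Type*} [NormedAddCommGroup ℋ] [InnerProductSpace ℂ ℋ]
    [NormedAddCommGroup H] [InnerProductSpace ℂ H] (V : S → (H →L[ℂ] ℋ)) : (S →₀ H) →ₗ[ℂ] ℋ :=
  Finsupp.lsum ℂ (fun s => (V s).toLinearMap)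

lemma kerForm_synth {ℋ H S : Type*} [NormedAddCommGroup ℋ]
    [InnerProductSpace ℂ ℋ] [CompleteSpace ℋ]
    [NormedAddCommGroup H] [InnerProductSpace ℂ H] [CompleteSpace H] (V : S → (H →L[ℂ] ℋ))
    (K : S → S → (H →L[ℂ] H)) (f : S →₀ H) :
    kerForm (fun s t => adjoint (V s) ∘L V t - K s t) f f
      = inner ℂ (synth V f) (synth V f) - kerForm K f f := by
  have key : ∀ s, Finsupp.lsum ℂ (fun t => (adjoint (V s) ∘L V t - K s t).toLinearMap) f
      = adjoint (V s) (synth V f) - Finsupp.lsum ℂ (fun t => (K s t).toLinearMap) f := by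
    intro s
    simp [synth, Finsupp.sum, map_sum]
  unfold kerForm
  simp only [key, inner_sub_right, adjoint_inner_right, Finsupp.sum_sub]
  congr 1
  conv_rhs => rw [synth, Finsupp.lsum_apply, Finsupp.sum, sum_inner]
  rfl

/-- If the feature map `V` is minimal (the span of `{V(s) h}` is dense in `ℋ`) and `K̃` is a
positive definite kernel dominated by `K_0(s,t) = V(s)* V(t)`, then there is a unique operator
`Q` with `0 ≤ Q ≤ I` such that `K̃(s,t) = V(s)* Q V(t)` for all `s, t`. -/
theorem dominated_kernel_representation {ℋ H S : Type*} [NormedAddCommGroup ℋ]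
    [InnerProductSpace ℂ ℋ] [CompleteSpace ℋ]
    [NormedAddCommGroup H] [InnerProductSpace ℂ H] [CompleteSpace H]
    [Nonempty S] (V : S → (H →L[ℂ] ℋ))
    (hmin : Dense ((Submodule.span ℂ {x : ℋ | ∃ (s : S) (h : H), V s h = x} : Submodule ℂ ℋ) : Set ℋ))
    (Kt : S → S → (H →L[ℂ] H)) (hKt : IsPosDefKernel Kt)
    (hdom : IsPosDefKernel (fun s t => adjoint (V s) ∘L V t - Kt s t)) :
    ∃! Q : ℋ →L[ℂ] ℋ, 0 ≤ Q ∧ Q ≤ 1 ∧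
      ∀ s t : S, Kt s t = adjoint (V s) ∘L (Q ∘L V t) := by
  have huniq : ∀ Q Q' : ℋ →L[ℂ] ℋ, (∀ s t : S, adjoint (V s) ∘L (Q ∘L V t)
      = adjoint (V s) ∘L (Q' ∘L V t)) → Q = Q' := by
    intro Q Q' h
    refine ContinuousLinearMap.ext_on hmin ?_
    rintro _ ⟨t, k, rfl⟩
    refine hmin.eq_of_inner_right ℂ fun v hv => ?_
    induction hv using Submodule.span_induction with
    | mem x hx =>
      obtain ⟨s, h', rfl⟩ := hx
      have := DFunLike.congr_fun (h s t) k
      simp only [comp_apply] at this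
      rw [← adjoint_inner_right, ← adjoint_inner_right, this]
    | zero => simp
    | add x y _ _ hx hy => simp only [inner_add_left, hx, hy]
    | smul c x _ hx => simp only [inner_smul_left, hx]
  obtain ⟨F, _, _, _, W, hW⟩ := exists_gns (kerCore Kt hKt)
  have hW' : ∀ f g, inner ℂ (W f) (W g) = kerForm Kt f g := hW
  have hdense : DenseRange (synth V) := by
    have : Submodule.span ℂ {x : ℋ | ∃ (s : S) (h : H), V s h = x}
        ≤ LinearMap.range (synth V) := by
      rw [Submodule.span_le]
      rintro _ ⟨s, h, rfl⟩
      exact ⟨Finsupp.single s h, by simp [synth]⟩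
    exact hmin.mono this
  have hnorm : ∀ f, ‖W f‖ ≤ 1 * ‖synth V f‖ := by
    intro f
    have h := kerForm_nonneg _ hdom f
    rw [kerForm_synth, ← hW', inner_self_eq_norm_sq_to_K, inner_self_eq_norm_sq_to_K] at h
    rw [one_mul]
    have h2 : ‖W f‖ ^ 2 ≤ ‖synth V f‖ ^ 2 := by
      rw [sub_nonneg] at h
      exact_mod_cast h
    exact le_of_sq_le_sq h2 (norm_nonneg _)
  let C : ℋ →L[ℂ] F := W.extendOfNorm (synth V)
  have hC : ∀ f, C (synth V f) = W f := W.extendOfNorm_eq hdense ⟨1, hnorm⟩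
  have hC1 : ∀ x, ‖C x‖ ≤ ‖x‖ := fun x => by
    simpa using W.norm_extendOfNorm_apply_le hdense 1 hnorm x
  have hrep : ∀ s t : S, Kt s t = adjoint (V s) ∘L ((adjoint C ∘L C) ∘L V t) := by
    intro s t
    ext k
    refine ext_inner_left ℂ fun h => ?_
    rw [← kerForm_single, ← hW', ← hC, ← hC]
    simp [synth, adjoint_inner_right]
  refine ⟨adjoint C ∘L C, ⟨?_, ?_, hrep⟩, ?_⟩
  · rw [nonneg_iff_isPositive]
    exact isPositive_adjoint_comp_self C
  · rw [ContinuousLinearMap.le_def, ContinuousLinearMap.isPositive_iff_complex]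
    intro x
    have : inner ℂ ((1 - adjoint C ∘L C) x) x = ((‖x‖ ^ 2 - ‖C x‖ ^ 2 : ℝ) : ℂ) := by
      simp [inner_sub_left, adjoint_inner_left, inner_self_eq_norm_sq_to_K]
    rw [this]
    rw [← RCLike.ofReal_eq_complex_ofReal, RCLike.ofReal_re]
    refine ⟨rfl, ?_⟩
    have := pow_le_pow_left₀ (norm_nonneg _) (hC1 x) 2
    linarith
  · rintro Q ⟨-, -, hQ⟩
    exact huniq _ _ fun s t => by rw [← hQ, ← hrep]
end
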